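/- arXiv:2311.10974 — 2 statements merged into one kernel-verified Lean document; each statement's English description precedes it below -/
import Mathlib

section
/- The Dunkl derivatives D_i = ∂/∂y_i + β Σ_{j≠i} (y_i − y_j)^{-1}(1 − K_{ij}) pairwise commute: [D_i, D_j] = 0 for all i, j, where K_{ij} is the operator swapping coordinates y_i and y_j acting on smooth functions of (y_1,...,y_N) with distinct coordinates. -/
/-- The coordinate swap operator: `(K_{ij} f) y = f (y ∘ swap i j)`. -/
def swapCoord {N : ℕ} (i j : Fin N) (y : Fin N → ℝ) : Fin N → ℝ :=
  y ∘ Equiv.swap i j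

/-- The Dunkl derivative
`D_i f y = ∂f/∂y_i + β ∑_{j ≠ i} (f y - f (σ_{ij} y)) / (y_i - y_j)`. -/
noncomputable def dunkl {N : ℕ} (β : ℝ) (i : Fin N) (f : (Fin N → ℝ) → ℝ) :
    (Fin N → ℝ) → ℝ :=
  fun y => fderiv ℝ f y (Pi.single i 1)
    + β * ∑ j ∈ Finset.univ.erase i, (f y - f (swapCoord i j y)) / (y i - y j)

namespace DunklAux

open Finset

lemma isOpen_inj (N : ℕ) : IsOpen {y : Fin N → ℝ | Function.Injective y} := by
  have : {y : Fin N → ℝ | Function.Injective y} =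
      ⋂ a : Fin N, ⋂ b : Fin N, {y : Fin N → ℝ | a ≠ b → y a ≠ y b} := by
    ext y
    simp only [Set.mem_ofPred_eq, Set.mem_iInter, Function.Injective]
    exact ⟨fun h a b hab e => hab (h e), fun h a b e => by
      by_contra hab; exact h a b hab e⟩
  rw [this]
  refine isOpen_iInter_of_finite fun a => isOpen_iInter_of_finite fun b => ?_
  by_cases hab : a = b
  · simp [hab]
  · simpa [hab] using isOpen_ne_fun (continuous_apply a) (continuous_apply b)

/-- The swap as a continuous linear map. -/
noncomputable def swapL {N : ℕ} (a b : Fin N) : (Fin N → ℝ) →L[ℝ] (Fin N → ℝ) :=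
  ContinuousLinearMap.pi fun m => ContinuousLinearMap.proj (Equiv.swap a b m)

lemma swapL_single {N : ℕ} (a b i : Fin N) :
    swapL a b (Pi.single i 1) = Pi.single (Equiv.swap a b i) 1 := by
  ext m
  simp only [swapL, ContinuousLinearMap.coe_pi', ContinuousLinearMap.proj_apply, Pi.single_apply]
  congr 1
  rw [eq_iff_iff, ← Equiv.swap_apply_eq_iff]

lemma fderiv_dunkl {N : ℕ} (β : ℝ) (i j : Fin N) (f : (Fin N → ℝ) → ℝ)
    (hf : ContDiffOn ℝ (⊤ : ℕ∞) f {y : Fin N → ℝ | Function.Injective y})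
    (y : Fin N → ℝ) (hy : Function.Injective y) :
    fderiv ℝ (dunkl β j f) y (Pi.single i 1) =
      fderiv ℝ (fderiv ℝ f) y (Pi.single i 1) (Pi.single j 1) +
      β * ∑ l ∈ univ.erase j,
        ((fderiv ℝ f y (Pi.single i 1)
          - fderiv ℝ f (swapCoord j l y) (Pi.single (Equiv.swap j l i) 1)) / (y j - y l)
        - (f y - f (swapCoord j l y)) *
          ((Pi.single i 1 : Fin N → ℝ) j - (Pi.single i 1 : Fin N → ℝ) l) / (y j - y l) ^ 2) := by
  have hO := isOpen_inj N
  have hd : ∀ z : Fin N → ℝ, Function.Injective z → HasFDerivAt f (fderiv ℝ f z) z := fun z hz =>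
    ((hf.contDiffAt (hO.mem_nhds hz)).differentiableAt (by simp)).hasFDerivAt
  have h2 : HasFDerivAt (fderiv ℝ f) (fderiv ℝ (fderiv ℝ f) y) y :=
    (((hf.contDiffAt (hO.mem_nhds hy)).fderiv_right (m := 1)
      (by rw [one_add_one_eq_two]; exact WithTop.coe_le_coe.2 (le_top : (2 : ℕ∞) ≤ ⊤))).differentiableAt (by simp)).hasFDerivAt
  have hs : ∀ l, HasFDerivAt (fun z => f (swapCoord j l z))
      ((fderiv ℝ f (swapCoord j l y)).comp (swapL j l)) y := fun l =>
    HasFDerivAt.comp (f := fun z => swapCoord j l z) y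
      (hd (swapCoord j l y) (hy.comp (Equiv.injective _)))
      ((swapL j l).hasFDerivAt)
  have hden : ∀ l, HasFDerivAt (fun z : Fin N → ℝ => z j - z l)
      ((ContinuousLinearMap.proj j : (Fin N → ℝ) →L[ℝ] ℝ) - ContinuousLinearMap.proj l) y :=
    fun l => (hasFDerivAt_apply j y).sub (hasFDerivAt_apply l y)
  have h1 : HasFDerivAt (fun z => fderiv ℝ f z (Pi.single j 1))
      (((ContinuousLinearMap.apply ℝ ℝ (Pi.single j (1:ℝ) : Fin N → ℝ))).comp
        (fderiv ℝ (fderiv ℝ f) y)) y :=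
    (ContinuousLinearMap.apply ℝ ℝ (Pi.single j (1:ℝ) : Fin N → ℝ)).hasFDerivAt.comp y h2
  have hne : ∀ l ∈ univ.erase j, y j - y l ≠ 0 := fun l hl e =>
    (Finset.ne_of_mem_erase hl) (hy (sub_eq_zero.1 e)).symm
  have hsum := HasFDerivAt.fun_sum (u := univ.erase j) fun l hl =>
    HasFDerivAt.fun_mul ((hd y hy).fun_sub (hs l))
      ((hasDerivAt_inv (hne l hl)).comp_hasFDerivAt y (hden l))
  have hall := h1.add (hsum.const_mul β)
  have e0 : dunkl β j f = (fun z => fderiv ℝ f z (Pi.single j 1)) +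
      fun z => β * ∑ l ∈ univ.erase j, (f z - f (swapCoord j l z)) *
        (Inv.inv ∘ fun z : Fin N → ℝ => z j - z l) z := by
    ext z
    simp [dunkl, div_eq_mul_inv]
  rw [e0, hall.fderiv]
  simp only [ContinuousLinearMap.add_apply, ContinuousLinearMap.smul_apply,
    ContinuousLinearMap.sum_apply, ContinuousLinearMap.sub_apply, ContinuousLinearMap.comp_apply,
    swapL_single, ContinuousLinearMap.proj_apply, smul_eq_mul, ContinuousLinearMap.apply_apply,
    Pi.sub_apply, Function.comp_apply]
  congr 2
  refine Finset.sum_congr rfl fun l hl => ?_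
  have := hne l hl
  field_simp
  ring

/-- Difference part of the Dunkl operator at a permuted point. -/
lemma diff_perm {N : ℕ} (j : Fin N) (f : (Fin N → ℝ) → ℝ) (y : Fin N → ℝ)
    (w : Equiv.Perm (Fin N)) :
    ∑ l ∈ univ.erase j, (f (y ∘ w) - f (swapCoord j l (y ∘ w))) / ((y ∘ w) j - (y ∘ w) l) =
    ∑ m ∈ univ.erase (w j), (f (y ∘ w) - f (y ∘ (Equiv.swap (w j) m * w : Equiv.Perm (Fin N))))
      / (y (w j) - y m) := by
  refine Finset.sum_equiv w (by simp) fun l _ => ?_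
  rw [← Equiv.mul_swap_eq_swap_mul]
  rfl

lemma erase_split {N : ℕ} {i j : Fin N} (h : i ≠ j) (g : Fin N → ℝ) :
    ∑ l ∈ univ.erase i, g l = g j + ∑ l ∈ (univ.erase i).erase j, g l :=
  (Finset.add_sum_erase _ g (by simp [h.symm])).symm

end DunklAux

open DunklAux Finset in
theorem diff_comm (N : ℕ) (i j : Fin N) (hij : i ≠ j)
    (f : (Fin N → ℝ) → ℝ) 
    (y : Fin N → ℝ) (hy : Function.Injective y) (T : Fin N → (Fin N → ℝ) → ℝ)
    (hT : ∀ j z, T j z = ∑ l ∈ univ.erase j, (f z - f (swapCoord j l z)) / (z j - z l)) :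
    ∑ k ∈ univ.erase i, (T j y - T j (swapCoord i k y)) / (y i - y k) = 
    ∑ k ∈ univ.erase j, (T i y - T i (swapCoord j k y)) / (y j - y k) := by
  set S := (univ.erase i).erase j with hS
  have hS' : (univ.erase j).erase i = S := Finset.erase_right_comm
  have mS : ∀ k ∈ S, k ≠ i ∧ k ≠ j := fun k hk => by simp [hS] at hk; tauto
  have hTp : ∀ (j : Fin N) (w : Equiv.Perm (Fin N)), T j (y ∘ w) = _ := fun j w =>
    (hT j _).trans (diff_perm j f y w)
  set F : Equiv.Perm (Fin N) → ℝ := fun w => f (y ∘ w) with hF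
  have hTp' : ∀ (j : Fin N) (w : Equiv.Perm (Fin N)), T j (y ∘ w) =
    ∑ m ∈ univ.erase (w j), (F w - F (Equiv.swap (w j) m * w)) / (y (w j) - y m) := hTp
  have hT1 : ∀ (j : Fin N), T j y =
    ∑ m ∈ univ.erase j, (F 1 - F (Equiv.swap j m)) / (y j - y m) := fun j => by
      simpa using hTp' j 1
  have main : ∀ i j : Fin N, i ≠ j → (univ.erase i).erase j = S → 
      ∑ k ∈ univ.erase i, (T j y - T j (swapCoord i k y)) / (y i - y k) =
      ∑ k ∈ S, (
       ∑ m ∈ S, (F 1 - F (Equiv.swap j m) - F (Equiv.swap i k) + F (Equiv.swap j m * Equiv.swap i k)) / (y j - y m) / (y i - y k)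
       + (F 1 - F (Equiv.swap i j) - F (Equiv.swap i k) + F (Equiv.swap i j * Equiv.swap i k)) / (y j - y i) / (y i - y k)
       + (F 1 - F (Equiv.swap j k)) / (y j - y k) / (y i - y j)
       - (F (Equiv.swap i j) - F (Equiv.swap i k * Equiv.swap i j)) / (y i - y k) / (y i - y j)) := by
    intro i j hij hSS
    have hSS' : (univ.erase j).erase i = S := Finset.erase_right_comm.trans hSS
    have mS : ∀ k ∈ S, k ≠ i ∧ k ≠ j := fun k hk => by simp [← hSS] at hk; tauto
    have hyij : y i - y j ≠ 0 := sub_ne_zero.2 fun e => hij (hy e)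
    have hyji : y j - y i ≠ 0 := sub_ne_zero.2 fun e => hij (hy e).symm
    rw [erase_split hij, hSS]
    have e1 : (T j y - T j (swapCoord i j y)) / (y i - y j) =
       ∑ k ∈ S, ((F 1 - F (Equiv.swap j k)) / (y j - y k) / (y i - y j)
       - (F (Equiv.swap i j) - F (Equiv.swap i k * Equiv.swap i j)) / (y i - y k) / (y i - y j)) := by
      rw [swapCoord, hTp', hT1, Equiv.swap_apply_right, erase_split hij, erase_split hij.symm, hSS, hSS',
        Equiv.swap_mul_self, Equiv.swap_comm j i, Finset.sum_sub_distrib, ← Finset.sum_div, ← Finset.sum_div]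
      field_simp
      ring
    have e2 : ∀ k ∈ S, (T j y - T j (swapCoord i k y)) / (y i - y k) =
      ∑ m ∈ S, (F 1 - F (Equiv.swap j m) - F (Equiv.swap i k) + F (Equiv.swap j m * Equiv.swap i k)) / (y j - y m) / (y i - y k)
       + (F 1 - F (Equiv.swap i j) - F (Equiv.swap i k) + F (Equiv.swap i j * Equiv.swap i k)) / (y j - y i) / (y i - y k) := by
      intro k hk
      rw [swapCoord, hTp', hT1, Equiv.swap_apply_of_ne_of_ne hij.symm (mS k hk).2.symm,
        ← Finset.sum_sub_distrib, erase_split hij.symm, hSS', Equiv.swap_comm j i, add_div, add_comm, Finset.sum_div]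
      congr 1
      · refine Finset.sum_congr rfl fun m _ => ?_
        ring
      · ring
    rw [e1, Finset.sum_congr rfl e2, ← Finset.sum_add_distrib]
    refine Finset.sum_congr rfl fun m _ => ?_
    ring
  rw [main i j hij rfl, main j i hij.symm hS']
  simp only [Finset.sum_add_distrib, Finset.sum_sub_distrib]
  have hdbl : ∑ k ∈ S, ∑ m ∈ S, (F 1 - F (Equiv.swap j m) - F (Equiv.swap i k) + F (Equiv.swap j m * Equiv.swap i k)) / (y j - y m) / (y i - y k)
     - ∑ k ∈ S, ∑ m ∈ S, (F 1 - F (Equiv.swap i m) - F (Equiv.swap j k) + F (Equiv.swap i m * Equiv.swap j k)) / (y i - y m) / (y j - y k)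
     = ∑ k ∈ S, (F (Equiv.swap j k * Equiv.swap i k) - F (Equiv.swap i k * Equiv.swap j k)) / (y j - y k) / (y i - y k) := by
    rw [Finset.sum_comm (s := S) (t := S) (f := fun k m => (F 1 - F (Equiv.swap i m) - F (Equiv.swap j k) + F (Equiv.swap i m * Equiv.swap j k)) / (y i - y m) / (y j - y k)),
      ← Finset.sum_sub_distrib]
    refine Finset.sum_congr rfl fun k hk => ?_
    rw [← Finset.sum_sub_distrib, Finset.sum_eq_single_of_mem k hk]
    · ring
    · intro m hm hmk
      have : Equiv.swap j m * Equiv.swap i k = Equiv.swap i k * Equiv.swap j m := by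
        rw [Equiv.mul_swap_eq_swap_mul, Equiv.swap_apply_of_ne_of_ne hij (mS m hm).1.symm,
          Equiv.swap_apply_of_ne_of_ne (mS k hk).2 hmk.symm]
      rw [this]
      ring
  rw [← sub_eq_zero]
  have hfin : ∀ k ∈ S, (F (Equiv.swap j k * Equiv.swap i k) - F (Equiv.swap i k * Equiv.swap j k)) / (y j - y k) / (y i - y k)
       + (F 1 - F (Equiv.swap i j) - F (Equiv.swap i k) + F (Equiv.swap i j * Equiv.swap i k)) / (y j - y i) / (y i - y k)
       + (F 1 - F (Equiv.swap j k)) / (y j - y k) / (y i - y j)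
       - (F (Equiv.swap i j) - F (Equiv.swap i k * Equiv.swap i j)) / (y i - y k) / (y i - y j)
       - (F 1 - F (Equiv.swap j i) - F (Equiv.swap j k) + F (Equiv.swap j i * Equiv.swap j k)) / (y i - y j) / (y j - y k)
       - (F 1 - F (Equiv.swap i k)) / (y i - y k) / (y j - y i)
       + (F (Equiv.swap j i) - F (Equiv.swap j k * Equiv.swap j i)) / (y j - y k) / (y j - y i) = 0 := by
    intro k hk
    obtain ⟨hki, hkj⟩ := mS k hk
    have a1 : Equiv.swap i k * Equiv.swap i j = Equiv.swap j k * Equiv.swap i k := by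
      rw [Equiv.mul_swap_eq_swap_mul, Equiv.swap_apply_left,
          Equiv.swap_apply_of_ne_of_ne hij.symm hkj.symm, Equiv.swap_comm k j]
    have a2 : Equiv.swap j i * Equiv.swap j k = Equiv.swap j k * Equiv.swap i k := by
      rw [Equiv.swap_comm j i, Equiv.mul_swap_eq_swap_mul, Equiv.swap_apply_right,
          Equiv.swap_apply_of_ne_of_ne hki hkj, a1]
    have a3 : Equiv.swap j k * Equiv.swap j i = Equiv.swap i k * Equiv.swap j k := by
      rw [Equiv.mul_swap_eq_swap_mul, Equiv.swap_apply_left,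
          Equiv.swap_apply_of_ne_of_ne hij hki.symm, Equiv.swap_comm k i]
    have a4 : Equiv.swap i j * Equiv.swap i k = Equiv.swap i k * Equiv.swap j k := by
      rw [Equiv.mul_swap_eq_swap_mul, Equiv.swap_apply_left,
          Equiv.swap_apply_of_ne_of_ne hki hkj, ← a3, Equiv.swap_comm j i,
          Equiv.mul_swap_eq_swap_mul (Equiv.swap j k), Equiv.swap_apply_left,
          Equiv.swap_apply_of_ne_of_ne hij hki.symm]
    rw [a1, a2, a3, a4, Equiv.swap_comm j i]
    have h1 : y i - y j ≠ 0 := sub_ne_zero.2 fun e => hij (hy e)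
    have h2 : y j - y i ≠ 0 := sub_ne_zero.2 fun e => hij (hy e).symm
    have h3 : y i - y k ≠ 0 := sub_ne_zero.2 fun e => hki (hy e).symm
    have h4 : y j - y k ≠ 0 := sub_ne_zero.2 fun e => hkj (hy e).symm
    rw [← neg_sub (y i) (y j)]
    field_simp
    ring
  have := Finset.sum_eq_zero hfin
  simp only [Finset.sum_add_distrib, Finset.sum_sub_distrib] at this hdbl
  linarith

open DunklAux Finset in
theorem stmt6 (N : ℕ) (hN : 2 ≤ N) (β : ℝ) (i j : Fin N)
    (f : (Fin N → ℝ) → ℝ)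
    (hf : ContDiffOn ℝ (⊤ : ℕ∞) f {y : Fin N → ℝ | Function.Injective y})
    (y : Fin N → ℝ) (hy : Function.Injective y) :
    dunkl β i (dunkl β j f) y = dunkl β j (dunkl β i f) y := by
  rcases eq_or_ne i j with rfl | hij
  · rfl
  have hsymm : fderiv ℝ (fderiv ℝ f) y (Pi.single i 1) (Pi.single j 1) =
      fderiv ℝ (fderiv ℝ f) y (Pi.single j 1) (Pi.single i 1) :=
    ((hf.contDiffAt ((isOpen_inj N).mem_nhds hy)).isSymmSndFDerivAt
      (by simpa using WithTop.coe_le_coe.2 (le_top : (2 : ℕ∞) ≤ ⊤))) _ _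
  have hX := diff_comm N i j hij f y hy
    (fun j z => ∑ l ∈ univ.erase j, (f z - f (swapCoord j l z)) / (z j - z l)) (fun _ _ => rfl)
  set T : Fin N → (Fin N → ℝ) → ℝ :=
    fun j z => ∑ l ∈ univ.erase j, (f z - f (swapCoord j l z)) / (z j - z l) with hT
  have hD : ∀ j z, dunkl β j f z = fderiv ℝ f z (Pi.single j 1) + β * T j z := fun _ _ => rfl
  have key : ∀ i j : Fin N, dunkl β i (dunkl β j f) y =
      fderiv ℝ (fderiv ℝ f) y (Pi.single i 1) (Pi.single j 1) + β * (
      ∑ l ∈ univ.erase j,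
        ((fderiv ℝ f y (Pi.single i 1)
          - fderiv ℝ f (swapCoord j l y) (Pi.single (Equiv.swap j l i) 1)) / (y j - y l)
        - (f y - f (swapCoord j l y)) *
          ((Pi.single i 1 : Fin N → ℝ) j - (Pi.single i 1 : Fin N → ℝ) l) / (y j - y l) ^ 2)
      + ∑ k ∈ univ.erase i, (fderiv ℝ f y (Pi.single j 1)
          - fderiv ℝ f (swapCoord i k y) (Pi.single j 1)) / (y i - y k))
      + β ^ 2 * ∑ k ∈ univ.erase i, (T j y - T j (swapCoord i k y)) / (y i - y k) := by
    intro i j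
    have e : ∑ k ∈ univ.erase i, (dunkl β j f y - dunkl β j f (swapCoord i k y)) / (y i - y k)
      = ∑ k ∈ univ.erase i, (fderiv ℝ f y (Pi.single j 1)
          - fderiv ℝ f (swapCoord i k y) (Pi.single j 1)) / (y i - y k)
        + β * ∑ k ∈ univ.erase i, (T j y - T j (swapCoord i k y)) / (y i - y k) := by
      rw [Finset.mul_sum, ← Finset.sum_add_distrib]
      refine Finset.sum_congr rfl fun k _ => ?_
      rw [hD, hD]
      ring
    rw [dunkl, fderiv_dunkl β i j f hf y hy, e]
    ring
  rw [key, key, hX, hsymm]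
  congr 3
  have mid : ∀ i j : Fin N, i ≠ j →
      ∑ l ∈ univ.erase j,
        ((fderiv ℝ f y (Pi.single i 1)
          - fderiv ℝ f (swapCoord j l y) (Pi.single (Equiv.swap j l i) 1)) / (y j - y l)
        - (f y - f (swapCoord j l y)) *
          ((Pi.single i 1 : Fin N → ℝ) j - (Pi.single i 1 : Fin N → ℝ) l) / (y j - y l) ^ 2)
      + ∑ k ∈ univ.erase i, (fderiv ℝ f y (Pi.single j 1)
          - fderiv ℝ f (swapCoord i k y) (Pi.single j 1)) / (y i - y k) =
      (fderiv ℝ f y (Pi.single j 1) - fderiv ℝ f y (Pi.single i 1)) / (y i - y j)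
      + (f y - f (swapCoord i j y)) / (y i - y j) ^ 2
      + ∑ k ∈ (univ.erase i).erase j, (fderiv ℝ f y (Pi.single i 1)
          - fderiv ℝ f (swapCoord j k y) (Pi.single i 1)) / (y j - y k)
      + ∑ k ∈ (univ.erase i).erase j, (fderiv ℝ f y (Pi.single j 1)
          - fderiv ℝ f (swapCoord i k y) (Pi.single j 1)) / (y i - y k) := by
    intro i j hij
    have hsw : swapCoord j i y = swapCoord i j y := by rw [swapCoord, swapCoord, Equiv.swap_comm]
    rw [erase_split hij, erase_split hij.symm, Finset.erase_right_comm (a := j) (b := i), hsw,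
      Equiv.swap_apply_right, Pi.single_eq_same, Pi.single_eq_of_ne hij.symm]
    have e : ∀ l ∈ (univ.erase i).erase j, ((fderiv ℝ f y (Pi.single i 1)
          - fderiv ℝ f (swapCoord j l y) (Pi.single (Equiv.swap j l i) 1)) / (y j - y l)
        - (f y - f (swapCoord j l y)) *
          ((0:ℝ) - (Pi.single i 1 : Fin N → ℝ) l) / (y j - y l) ^ 2) =
        (fderiv ℝ f y (Pi.single i 1)
          - fderiv ℝ f (swapCoord j l y) (Pi.single i 1)) / (y j - y l) := by
      intro l hl
      have hli : l ≠ i := by simp at hl; tauto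
      rw [Equiv.swap_apply_of_ne_of_ne hij hli.symm, Pi.single_eq_of_ne hli]
      simp
    rw [Finset.sum_congr rfl e]
    have h1 : y i - y j ≠ 0 := sub_ne_zero.2 fun e => hij (hy e)
    rw [← neg_sub (y i) (y j)]
    field_simp
    ring
  have hsw : swapCoord j i y = swapCoord i j y := by rw [swapCoord, swapCoord, Equiv.swap_comm]
  rw [mid i j hij, mid j i hij.symm, Finset.erase_right_comm (a := j) (b := i), hsw,
    ← neg_sub (y i) (y j), div_neg, neg_sq]
  ring
end

section
/- Define L_{−n} = Σ_i (α (a_i^†)^{n+1} a_i + (1−α) a_i (a_i^†)^{n+1}) in the deformed oscillator algebra. Then [L_n, L_m] = (n − m) L_{n+m}, i.e., these generators realize the Witt (centerless Virasoro) algebra. -/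
namespace Witt
open Finset

/-- complete homogeneous polynomial of degree `r - 1` in two variables -/
noncomputable def hh {N : ℕ} (r : ℕ) (i j : Fin N) : MvPolynomial (Fin N) ℝ :=
  ∑ p ∈ range r, MvPolynomial.X i ^ p * MvPolynomial.X j ^ (r - 1 - p)

lemma hh_mul {N : ℕ} (r : ℕ) (i j : Fin N) :
    hh r i j * (MvPolynomial.X i - MvPolynomial.X j)
      = MvPolynomial.X i ^ r - MvPolynomial.X j ^ r :=
  (Commute.all _ _).geom_sum₂_mul r

lemma hh_symm {N : ℕ} (r : ℕ) (i j : Fin N) : hh r i j = hh r j i :=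
  (Commute.all _ _).geom_sum₂_comm r

lemma hh_succ {N : ℕ} (r : ℕ) (i j : Fin N) :
    hh (r + 1) i j = MvPolynomial.X i ^ r + MvPolynomial.X j * hh r i j :=
  (Commute.all _ _).geom_sum₂_succ_eq

lemma hh_self {N : ℕ} (r : ℕ) (i : Fin N) :
    hh r i i = (r : ℝ) • MvPolynomial.X i ^ (r - 1) := by
  have := (geom_sum₂_self (MvPolynomial.X i : MvPolynomial (Fin N) ℝ) r)
  rw [hh, this, Nat.cast_smul_eq_nsmul, nsmul_eq_mul]

lemma hh_cyc {N : ℕ} (r s : ℕ) (i j k : Fin N) (hij : i ≠ j) (hjk : j ≠ k) (hki : k ≠ i) :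
    hh r i j * (hh s i k - hh s j k) + hh r j k * (hh s j i - hh s k i)
      + hh r k i * (hh s k j - hh s i j) = 0 := by
  have e1 : (MvPolynomial.X i - MvPolynomial.X j : MvPolynomial (Fin N) ℝ) ≠ 0 :=
    sub_ne_zero.2 fun h => hij (MvPolynomial.X_injective h)
  have e2 : (MvPolynomial.X j - MvPolynomial.X k : MvPolynomial (Fin N) ℝ) ≠ 0 :=
    sub_ne_zero.2 fun h => hjk (MvPolynomial.X_injective h)
  have e3 : (MvPolynomial.X k - MvPolynomial.X i : MvPolynomial (Fin N) ℝ) ≠ 0 :=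
    sub_ne_zero.2 fun h => hki (MvPolynomial.X_injective h)
  rw [hh_symm s i k, hh_symm s j i, hh_symm s k j]
  have a1 := hh_mul r i j
  have a2 := hh_mul r j k
  have a3 := hh_mul r k i
  have b1 := hh_mul s i j
  have b2 := hh_mul s j k
  have b3 := hh_mul s k i
  generalize hh r i j = A1 at *
  generalize hh r j k = A2 at *
  generalize hh r k i = A3 at *
  generalize hh s i j = B1 at *
  generalize hh s j k = B2 at *
  generalize hh s k i = B3 at *
  generalize (MvPolynomial.X i : MvPolynomial (Fin N) ℝ) = x at *
  generalize (MvPolynomial.X j : MvPolynomial (Fin N) ℝ) = y at *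
  generalize (MvPolynomial.X k : MvPolynomial (Fin N) ℝ) = z at *
  apply mul_left_cancel₀ (mul_ne_zero (mul_ne_zero e1 e2) e3)
  have c1 : A3 * (z - x) = - (A1 * (x - y)) - A2 * (y - z) := by
    linear_combination a1 + a2 + a3
  have c2 : B3 * (z - x) = - (B1 * (x - y)) - B2 * (y - z) := by
    linear_combination b1 + b2 + b3
  linear_combination ((x-y)*(y-z)*(A1-A2))*c2 + ((x-y)*(y-z)*(B2 - B1)) * c1

lemma exists_phi {A : Type*} [Ring A] [Algebra ℝ A] {N : ℕ} (x : Fin N → A)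
    (hx : ∀ i j, x i * x j = x j * x i) :
    ∃ φ : MvPolynomial (Fin N) ℝ →ₐ[ℝ] A, ∀ i, φ (MvPolynomial.X i) = x i := by
  let S := Algebra.adjoin ℝ (Set.range x)
  letI : CommRing S := Algebra.adjoinCommRingOfComm ℝ (by
    rintro _ ⟨i, rfl⟩ _ ⟨j, rfl⟩; exact hx i j)
  let y : Fin N → S := fun i => ⟨x i, Algebra.subset_adjoin ⟨i, rfl⟩⟩
  refine ⟨S.val.comp (MvPolynomial.aeval y), fun i => ?_⟩
  simp [y]

section
variable {A : Type*} [Ring A] [Algebra ℝ A] {N : ℕ} (β : ℝ)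
    (a x : Fin N → A) (K : Fin N → Fin N → A)
    (φ : MvPolynomial (Fin N) ℝ →ₐ[ℝ] A)

/-- K commutes past polynomials -/
lemma K_phi (hφ : ∀ i, φ (MvPolynomial.X i) = x i)
    (hKx : ∀ i j k, K i j * x k = x (Equiv.swap i j k) * K i j) (i j : Fin N)
    (p : MvPolynomial (Fin N) ℝ) :
    K i j * φ p = φ (MvPolynomial.rename (Equiv.swap i j) p) * K i j := by
  induction p using MvPolynomial.induction_on with
  | C c =>
    rw [MvPolynomial.rename_C, ← MvPolynomial.algebraMap_eq, AlgHom.commutes]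
    exact (Algebra.commutes _ _).symm
  | add p q hp hq => rw [map_add, map_add, map_add, mul_add, add_mul, hp, hq]
  | mul_X p k hp =>
    rw [map_mul, map_mul, map_mul, ← mul_assoc, hp, mul_assoc, MvPolynomial.rename_X, hφ, hφ, hKx,
      mul_assoc]

lemma rename_hh (e : Equiv.Perm (Fin N)) (r : ℕ) (i j : Fin N) :
    MvPolynomial.rename e (hh r i j) = hh r (e i) (e j) := by
  simp [hh]

lemma comm_pow (hφ : ∀ i, φ (MvPolynomial.X i) = x i)
    (hKx : ∀ i j k, K i j * x k = x (Equiv.swap i j k) * K i j)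
    (haad : ∀ i j, a i * x j - x j * a i
      = (if i = j then 1 + β • ∑ l, K i l else 0) - β • K i j) (r : ℕ) (i j : Fin N) :
    a i * x j ^ r - x j ^ r * a i =
      (if i = j then (r : ℝ) • x i ^ (r - 1) + β • ∑ l, φ (hh r i l) * K i l else 0)
        - β • (φ (hh r i j) * K i j) := by
  induction r with
  | zero => simp [hh]
  | succ r ih =>
    have hK : ∀ l, K i l * x i ^ r = φ (MvPolynomial.X l ^ r) * K i l := by
      intro l
      rw [← hφ, ← map_pow, K_phi x K φ hφ hKx]; simp
    have hK' : K i j * x j ^ r = φ (MvPolynomial.X i ^ r) * K i j := by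
      rw [← hφ, ← map_pow, K_phi x K φ hφ hKx]; simp
    have e : a i * x j ^ (r+1) - x j ^ (r+1) * a i
        = x j * (a i * x j ^ r - x j ^ r * a i) + (a i * x j - x j * a i) * x j ^ r := by
      rw [pow_succ']; noncomm_ring
    rw [e, ih, haad]
    have h1 : φ (hh (r+1) i j) * K i j = x j * (φ (hh r i j) * K i j) + K i j * x j ^ r := by
      rw [hK', hh_succ, map_add, map_mul, hφ]; noncomm_ring
    rw [h1]
    by_cases hij : i = j
    · subst hij
      have h2 : ∀ l, φ (hh (r+1) i l) * K i l = x i * (φ (hh r i l) * K i l) + K i l * x i ^ r := by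
        intro l
        rw [hK, hh_symm, hh_succ, map_add, map_mul, hφ, hh_symm]; noncomm_ring
      simp only [if_true, h2, sum_add_distrib, ← mul_sum, ← sum_mul]
      have h3 : ((r + 1 : ℕ) : ℝ) • x i ^ (r + 1 - 1) = x i * ((r:ℝ) • x i ^ (r-1)) + x i ^ r := by
        rcases r with _ | r
        · simp
        · simp only [Nat.add_sub_cancel, mul_smul_comm, ← pow_succ']
          push_cast; module
      rw [h3]
      simp only [mul_sub, mul_add, sub_mul, add_mul, mul_smul_comm, smul_mul_assoc, smul_add, one_mul]
      abel
    · simp only [if_neg hij, mul_sub, sub_mul, mul_smul_comm, smul_mul_assoc, smul_add]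
      noncomm_ring

lemma E_witt (hKsymm : ∀ i j, K i j = K j i)
    (hKx : ∀ i j k, K i j * x k = x (Equiv.swap i j k) * K i j)
    (haa : ∀ i j, a i * a j = a j * a i)
    (hxx : ∀ i j, x i * x j = x j * x i)
    (haad : ∀ i j, a i * x j - x j * a i
      = (if i = j then 1 + β • ∑ l, K i l else 0) - β • K i j) (n m : ℕ) :
    (∑ i, x i ^ (n+1) * a i) * (∑ i, x i ^ (m+1) * a i)
      - (∑ i, x i ^ (m+1) * a i) * (∑ i, x i ^ (n+1) * a i)
      = ((m:ℝ) - (n:ℝ)) • ∑ i, x i ^ (n+m+1) * a i := by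
  obtain ⟨φ, hφ⟩ := exists_phi x hxx
  have hc := comm_pow β a x K φ hφ hKx haad
  let U : ℕ → ℕ → A := fun n m =>
    ∑ i, ∑ j, φ (MvPolynomial.X i ^ (n+1) * hh (m+1) i j) * K i j * (a i - a j)
  have hU2 : ∀ n m, (2:ℝ) • U n m = ∑ i, ∑ j,
      φ (hh (n+1) i j * (MvPolynomial.X i - MvPolynomial.X j) * hh (m+1) i j)
        * K i j * (a i - a j) := by
    intro n m
    have : U n m = ∑ i, ∑ j,
        φ (MvPolynomial.X j ^ (n+1) * hh (m+1) i j) * K i j * (a j - a i) := by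
      simp only [U]
      rw [sum_comm]
      refine sum_congr rfl fun i _ => sum_congr rfl fun j _ => ?_
      rw [hKsymm j i, hh_symm]
    rw [two_smul]
    nth_rewrite 2 [this]
    simp only [U, ← sum_add_distrib]
    refine sum_congr rfl fun i _ => sum_congr rfl fun j _ => ?_
    rw [hh_mul, sub_mul, map_sub]
    noncomm_ring
  have hUs : U n m = U m n := by
    have : (2:ℝ) • U n m = (2:ℝ) • U m n := by
      rw [hU2, hU2]
      refine sum_congr rfl fun i _ => sum_congr rfl fun j _ => ?_
      congr 3; ring
    exact smul_right_injective A (two_ne_zero : (2:ℝ) ≠ 0) this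
  have hW : ∀ n m, ∑ i, ∑ j, x i ^ (n+1) * (a i * x j ^ (m+1) - x j ^ (m+1) * a i) * a j
      = ((m+1 : ℕ):ℝ) • (∑ i, x i ^ (n+m+1) * a i) + β • U n m := by
    intro n m
    simp only [hc, U, smul_sum, ← sum_add_distrib]
    refine sum_congr rfl fun i _ => ?_
    simp only [mul_sub, sub_mul, sum_sub_distrib, mul_ite, ite_mul, mul_zero, zero_mul,
      sum_ite_eq, mem_univ, if_true, smul_sub, mul_add, add_mul]
    simp only [map_mul, map_pow, hφ, mul_smul_comm, smul_mul_assoc, mul_sum, sum_mul, smul_sum,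
      mul_assoc]
    rw [← mul_assoc, ← pow_add]
    have : n + 1 + (m + 1 - 1) = n + m + 1 := by omega
    rw [this]
    abel
  have main : (∑ i, x i ^ (n+1) * a i) * (∑ i, x i ^ (m+1) * a i)
      - (∑ i, x i ^ (m+1) * a i) * (∑ i, x i ^ (n+1) * a i)
      = ∑ i, ∑ j, x i ^ (n+1) * (a i * x j ^ (m+1) - x j ^ (m+1) * a i) * a j
       - ∑ i, ∑ j, x i ^ (m+1) * (a i * x j ^ (n+1) - x j ^ (n+1) * a i) * a j := by
    have e : ∀ n m, (∑ i, x i ^ (n+1) * a i) * (∑ i, x i ^ (m+1) * a i)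
       = ∑ i, ∑ j, x i ^ (n+1) * (a i * x j ^ (m+1) - x j ^ (m+1) * a i) * a j
        + ∑ i, ∑ j, x i ^ (n+1) * x j ^ (m+1) * (a i * a j) := by
      intro n m
      simp only [sum_mul_sum, ← sum_add_distrib]
      refine sum_congr rfl fun i _ => sum_congr rfl fun j _ => ?_
      noncomm_ring
    have e2 : ∑ i, ∑ j, x i ^ (n+1) * x j ^ (m+1) * (a i * a j)
        = ∑ i, ∑ j, x i ^ (m+1) * x j ^ (n+1) * (a i * a j) := by
      rw [sum_comm]
      refine sum_congr rfl fun i _ => sum_congr rfl fun j _ => ?_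
      rw [haa j i, ((show Commute (x j) (x i) from hxx j i).pow_pow (n+1) (m+1)).eq]
    rw [e n m, e m n, e2]; abel
  rw [main, hW, hW, hUs, add_comm m n]
  push_cast
  module

lemma F_witt (hKsymm : ∀ i j, K i j = K j i)
    (hKx : ∀ i j k, K i j * x k = x (Equiv.swap i j k) * K i j)
    (haa : ∀ i j, a i * a j = a j * a i)
    (hxx : ∀ i j, x i * x j = x j * x i)
    (haad : ∀ i j, a i * x j - x j * a i
      = (if i = j then 1 + β • ∑ l, K i l else 0) - β • K i j) (n m : ℕ) :
    (∑ i, a i * x i ^ (n+1)) * (∑ i, a i * x i ^ (m+1))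
      - (∑ i, a i * x i ^ (m+1)) * (∑ i, a i * x i ^ (n+1))
      = ((m:ℝ) - (n:ℝ)) • ∑ i, a i * x i ^ (n+m+1) := by
  have h := E_witt (A := Aᵐᵒᵖ) β (fun i => -MulOpposite.op (a i)) (fun i => MulOpposite.op (x i))
    (fun i j => MulOpposite.op (K i j)) (fun i j => by rw [hKsymm])
    (fun i j k => by
      simp only [← MulOpposite.op_mul]
      rw [hKx]; simp)
    (fun i j => by
      simp only [neg_mul_neg, ← MulOpposite.op_mul]
      rw [haa])
    (fun i j => by
      simp only [← MulOpposite.op_mul]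
      rw [hxx])
    (fun i j => by
      have := congrArg MulOpposite.op (haad i j)
      have e : -MulOpposite.op (a i) * MulOpposite.op (x j) - MulOpposite.op (x j) * -MulOpposite.op (a i)
          = MulOpposite.op (a i * x j - x j * a i) := by
        simp only [MulOpposite.op_sub, MulOpposite.op_mul]
        noncomm_ring
      rw [e, this]
      split_ifs <;> simp) n m
  have h2 := congrArg MulOpposite.unop h
  simp only [mul_neg, sum_neg_distrib, neg_mul_neg, ← MulOpposite.op_pow, ← MulOpposite.op_mul,
    Finset.unop_sum, MulOpposite.unop_sub, MulOpposite.unop_mul, MulOpposite.unop_op,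
    MulOpposite.unop_smul, MulOpposite.unop_neg, smul_neg, neg_mul, neg_neg] at h2
  rw [← neg_inj, ← h2]
  abel

/-- sum supported on pairs with exactly one entry in `{j,k}` -/
lemma sum_pairs (f : Fin N → Fin N → A) (j k : Fin N) (hjk : j ≠ k)
    (hs : ∀ i l, f i l = f l i)
    (h0 : ∀ i l, i ≠ j → i ≠ k → l ≠ j → l ≠ k → f i l = 0)
    (h1 : f j j + f k k = 0) (h2 : f j k = 0) :
    ∑ i, ∑ l, f i l = (2:ℝ) • ∑ l, (if l ≠ j ∧ l ≠ k then f j l + f k l else 0) := by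
  have h2' : f k j = 0 := by rw [hs, h2]
  have e : ∀ i l, f i l = ((if i = j then (if l ≠ j ∧ l ≠ k then f j l else 0) else 0)
      + (if i = k then (if l ≠ j ∧ l ≠ k then f k l else 0) else 0))
      + ((if l = j then (if i ≠ j ∧ i ≠ k then f j i else 0) else 0)
      + (if l = k then (if i ≠ j ∧ i ≠ k then f k i else 0) else 0))
      + ((if i = j then (if l = j then f j j else 0) else 0)
      + (if i = k then (if l = k then f k k else 0) else 0)) := by
    intro i l
    by_cases a1 : i = j
    · subst a1
      by_cases b1 : l = i
      · subst b1; simp [hjk]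
      · by_cases b2 : l = k
        · subst b2; simp [h2, hjk, hjk.symm]
        · simp [b1, b2, hjk]
    · by_cases a2 : i = k
      · subst a2
        by_cases b1 : l = j
        · subst b1; simp [h2', hjk.symm, hjk]
        · by_cases b2 : l = i
          · subst b2; simp [a1]
          · simp [b1, b2, a1]
      · by_cases b1 : l = j
        · subst b1; simp [a1, a2, hjk, hs i]
        · by_cases b2 : l = k
          · subst b2; simp [a1, a2, b1, hs i]
          · simp [a1, a2, b1, b2, h0]
  have g : ∀ l, (if l ≠ j ∧ l ≠ k then f j l + f k l else 0)
     = (if l ≠ j ∧ l ≠ k then f j l else 0) + (if l ≠ j ∧ l ≠ k then f k l else 0) := by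
    intro l; split_ifs <;> simp
  rw [sum_congr rfl fun i _ => sum_congr rfl fun l _ => e i l]
  have d : ∀ (q : Fin N) (z : A),
      ∑ i, ∑ l, (if i = q then (if l = q then z else 0) else 0) = z := by
    intro q z
    rw [sum_comm]
    simp only [sum_ite_eq', mem_univ, if_true]
  simp only [g, sum_add_distrib, two_smul, d, h1, add_zero]
  congr 1
  · rw [sum_comm, sum_comm (f := fun i l => if i = k then _ else _)]
    simp only [sum_ite_eq', mem_univ, if_true]
  · simp only [sum_ite_eq', mem_univ, if_true]

/-- the exchange part -/
noncomputable def T (n : ℕ) : A := ∑ i, ∑ j, φ (hh (n+1) i j) * K i j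

lemma T_comm (hφ : ∀ i, φ (MvPolynomial.X i) = x i)
    (hKsymm : ∀ i j, K i j = K j i)
    (hKii : ∀ i, K i i = 1)
    (hKx : ∀ i j k, K i j * x k = x (Equiv.swap i j k) * K i j)
    (hKK : ∀ i j k l, K i j * K k l = K (Equiv.swap i j k) (Equiv.swap i j l) * K i j) (n m : ℕ) :
    T K φ n * T K φ m = T K φ m * T K φ n := by
  have hKp := K_phi x K φ hφ hKx
  have hKT : ∀ i l n, K i l * T K φ n = T K φ n * K i l := by
    intro i l n
    simp only [T, mul_sum, sum_mul]
    rw [← Equiv.sum_comp (Equiv.swap i l) (fun j => ∑ k, φ (hh (n+1) j k) * K j k * K i l)]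
    refine sum_congr rfl fun j _ => ?_
    rw [← Equiv.sum_comp (Equiv.swap i l)
      (fun k => φ (hh (n+1) (Equiv.swap i l j) k) * K (Equiv.swap i l j) k * K i l)]
    refine sum_congr rfl fun k _ => ?_
    rw [← mul_assoc, hKp, rename_hh, mul_assoc, hKK, mul_assoc]
  let f : Fin N → Fin N → Fin N → Fin N → A := fun j k i l =>
    φ (hh (m+1) j k * (hh (n+1) i l - hh (n+1) (Equiv.swap j k i) (Equiv.swap j k l)))
      * (K j k * K i l)
  let P : Fin N → Fin N → Fin N → A := fun j k l => if j ≠ k ∧ l ≠ j ∧ l ≠ k then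
    φ (hh (m+1) j k * (hh (n+1) j l - hh (n+1) k l)) * (K j k * K j l) else 0
  have e1 : T K φ n * T K φ m - T K φ m * T K φ n = ∑ j, ∑ k, ∑ i, ∑ l, f j k i l := by
    have a1 : T K φ n * T K φ m = ∑ j, ∑ k, ∑ i, ∑ l,
        φ (hh (m+1) j k) * φ (hh (n+1) i l) * (K j k * K i l) := by
      have : T K φ n * T K φ m = ∑ i, ∑ l, φ (hh (n+1) i l) * (T K φ m * K i l) := by
        simp only [← hKT]
        nth_rewrite 1 [T]
        simp only [sum_mul, mul_assoc]
      rw [this]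
      simp only [T, sum_mul, mul_sum]
      have c : ∀ F : Fin N → Fin N → Fin N → Fin N → A,
          ∑ i, ∑ l, ∑ j, ∑ k, F i l j k = ∑ j, ∑ k, ∑ i, ∑ l, F i l j k := by
        intro F
        calc _ = ∑ i, ∑ j, ∑ l, ∑ k, F i l j k := sum_congr rfl fun i _ => sum_comm
          _ = ∑ j, ∑ i, ∑ l, ∑ k, F i l j k := sum_comm
          _ = ∑ j, ∑ i, ∑ k, ∑ l, F i l j k :=
            sum_congr rfl fun i _ => sum_congr rfl fun i _ => sum_comm
          _ = _ := sum_congr rfl fun i _ => sum_comm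
      rw [c]
      refine sum_congr rfl fun j _ => sum_congr rfl fun k _ => sum_congr rfl fun i _ =>
        sum_congr rfl fun l _ => ?_
      rw [← map_mul, mul_comm (hh (m+1) j k), map_mul]
      simp only [mul_assoc]
    have a2 : T K φ m * T K φ n = ∑ j, ∑ k, ∑ i, ∑ l,
        φ (hh (m+1) j k) * φ (hh (n+1) (Equiv.swap j k i) (Equiv.swap j k l))
          * (K j k * K i l) := by
      simp only [T, sum_mul]
      refine sum_congr rfl fun j _ => sum_congr rfl fun k _ => ?_
      simp only [mul_sum]
      refine sum_congr rfl fun i _ => sum_congr rfl fun l _ => ?_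
      rw [mul_assoc, ← mul_assoc (K j k), hKp, rename_hh]
      simp only [mul_assoc]
    rw [a1, a2]
    simp only [f, ← sum_sub_distrib]
    refine sum_congr rfl fun j _ => sum_congr rfl fun k _ => sum_congr rfl fun i _ =>
        sum_congr rfl fun l _ => ?_
    rw [mul_sub, map_sub, map_mul, map_mul, sub_mul]
  have e2 : ∀ j k, ∑ i, ∑ l, f j k i l = (2:ℝ) • ∑ l, (P j k l + P k j l) := by
    intro j k
    by_cases hjk : j = k
    · subst hjk
      simp [f, P]
    · rw [sum_pairs (f j k) j k hjk]
      · congr 1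
        refine sum_congr rfl fun l _ => ?_
        by_cases h : l ≠ j ∧ l ≠ k
        · have h' : l ≠ k ∧ l ≠ j := h.symm
          simp only [P, f, if_pos h, hjk, h.1, h.2, ne_eq, Ne.symm hjk, not_false_eq_true,
            and_self, if_true, Equiv.swap_apply_left, Equiv.swap_apply_right,
            Equiv.swap_apply_of_ne_of_ne h.1 h.2]
          rw [hh_symm (m+1) k j, hKsymm k j]
        · have h' : ¬ (l ≠ k ∧ l ≠ j) := fun q => h q.symm
          simp only [P, if_neg h, h, h', and_false, if_false, add_zero]
      · intro i l
        simp only [f]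
        rw [hh_symm (n+1) i l, hh_symm (n+1) (Equiv.swap j k i), hKsymm i l]
      · intro i l h1 h2 h3 h4
        simp only [f, Equiv.swap_apply_of_ne_of_ne h1 h2, Equiv.swap_apply_of_ne_of_ne h3 h4]
        simp
      all_goals
        simp only [f, Equiv.swap_apply_left, Equiv.swap_apply_right]
      · rw [hKii, hKii, ← add_mul, ← map_add, ← mul_add]; simp
      · rw [hh_symm (n+1) k j]; simp
  have e3 : ∀ j k l, P j k l + P k l j + P l j k = 0 := by
    intro j k l
    by_cases h : j ≠ k ∧ l ≠ j ∧ l ≠ k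
    · obtain ⟨h1, h2, h3⟩ := h
      have k1 : K k l * K k j = K j k * K j l := by
        have := hKK j k j l
        rw [Equiv.swap_apply_left, Equiv.swap_apply_of_ne_of_ne h2 h3] at this
        rw [this, hKsymm j k]
      have k2 : K l j * K l k = K j k * K j l := by
        have := hKK j l j k
        have t := hKK j k l j
        rw [Equiv.swap_apply_left, Equiv.swap_apply_of_ne_of_ne h2 h3] at t
        have t2 := hKK l j l k
        rw [Equiv.swap_apply_left, Equiv.swap_apply_of_ne_of_ne h3.symm h1.symm] at t2
        rw [t2, hKsymm l j]
      simp only [P, h1, h2, h3, Ne.symm h1, Ne.symm h2, Ne.symm h3, ne_eq, not_false_eq_true,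
        and_self, if_true]
      rw [k1, k2, ← add_mul, ← add_mul, ← map_add, ← map_add, hh_cyc _ _ j k l h1 h3.symm h2]
      simp
    · have h' : ¬ (k ≠ l ∧ j ≠ k ∧ j ≠ l) := fun q => h ⟨q.2.1, q.2.2.symm, q.1.symm⟩
      have h'' : ¬ (l ≠ j ∧ k ≠ l ∧ k ≠ j) := fun q => h ⟨q.2.2.symm, q.1, q.2.1.symm⟩
      simp only [P, if_neg h, if_neg h', if_neg h'', add_zero]
  have r1 : ∑ j, ∑ k, ∑ l, P k l j = ∑ j, ∑ k, ∑ l, P j k l := by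
    rw [sum_comm]
    exact sum_congr rfl fun i _ => sum_comm
  have r2 : ∑ j, ∑ k, ∑ l, P l j k = ∑ j, ∑ k, ∑ l, P j k l := by
    rw [← r1, ← Finset.sum_comm]
    rw [sum_comm]
    calc _ = ∑ j, ∑ l, ∑ k, P l j k := sum_congr rfl fun i _ => sum_comm
      _ = ∑ l, ∑ j, ∑ k, P l j k := sum_comm
      _ = _ := r1.symm
  have e4 : ∑ j, ∑ k, ∑ l, P j k l = 0 := by
    have : (3:ℝ) • ∑ j, ∑ k, ∑ l, P j k l = 0 := by
      have q : ∑ j, ∑ k, ∑ l, (P j k l + P k l j + P l j k) = 0 := by simp only [e3, sum_const_zero]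
      simp only [sum_add_distrib, r1, r2] at q
      rw [← q]; module
    exact (smul_eq_zero.1 this).resolve_left (by norm_num)
  rw [← sub_eq_zero, e1]
  simp only [e2, ← smul_sum, sum_add_distrib]
  rw [sum_comm (f := fun j k => ∑ l, P k j l), e4]
  simp

lemma C_eq (hφ : ∀ i, φ (MvPolynomial.X i) = x i) (hKii : ∀ i, K i i = 1)
    (hKx : ∀ i j k, K i j * x k = x (Equiv.swap i j k) * K i j)
    (haad : ∀ i j, a i * x j - x j * a i
      = (if i = j then 1 + β • ∑ l, K i l else 0) - β • K i j) (n : ℕ) :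
    ∑ i, (a i * x i ^ (n+1) - x i ^ (n+1) * a i)
      = ((1 - β) * ((n+1 : ℕ) : ℝ)) • φ (∑ i, MvPolynomial.X i ^ n) + β • T K φ n := by
  simp only [comm_pow β a x K φ hφ hKx haad, if_true, hh_self, hKii, T, map_sum, smul_sum,
    ← sum_add_distrib]
  refine sum_congr rfl fun i _ => ?_
  simp only [map_smul, map_pow, hφ, mul_one, Nat.add_sub_cancel]
  module

lemma C_comm (hKsymm : ∀ i j, K i j = K j i) (hKii : ∀ i, K i i = 1)
    (hKx : ∀ i j k, K i j * x k = x (Equiv.swap i j k) * K i j)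
    (hKa : ∀ i j k, K i j * a k = a (Equiv.swap i j k) * K i j)
    (hxx : ∀ i j, x i * x j = x j * x i)
    (haad : ∀ i j, a i * x j - x j * a i
      = (if i = j then 1 + β • ∑ l, K i l else 0) - β • K i j) (n m : ℕ) :
    Commute (∑ i, (a i * x i ^ (n+1) - x i ^ (n+1) * a i))
      (∑ i, (a i * x i ^ (m+1) - x i ^ (m+1) * a i)) := by
  obtain ⟨φ, hφ⟩ := exists_phi x hxx
  rw [C_eq β a x K φ hφ hKii hKx haad, C_eq β a x K φ hφ hKii hKx haad]
  have hφφ : ∀ p q, Commute (φ p) (φ q) := fun p q => by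
    rw [Commute, SemiconjBy, ← map_mul, mul_comm, map_mul]
  have hpT : ∀ n m, Commute (φ (∑ i, MvPolynomial.X i ^ n)) (T K φ m) := by
    intro n m
    refine Commute.sum_right _ _ _ fun i _ => Commute.sum_right _ _ _ fun j _ => ?_
    refine (hφφ _ _).mul_right ?_
    have := K_phi x K φ hφ hKx i j (∑ i, MvPolynomial.X i ^ n)
    have hr : MvPolynomial.rename (Equiv.swap i j)
        (∑ i, (MvPolynomial.X i : MvPolynomial (Fin N) ℝ) ^ n) = ∑ i, MvPolynomial.X i ^ n := by
      rw [map_sum]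
      simp only [map_pow, MvPolynomial.rename_X]
      exact Equiv.sum_comp (Equiv.swap i j)
        (fun i => (MvPolynomial.X i : MvPolynomial (Fin N) ℝ) ^ n)
    rw [hr] at this
    exact this.symm
  have hTT : Commute (β • T K φ n) (β • T K φ m) := by
    by_cases hβ : β = 0
    · subst hβ; simp
    · have hKK : ∀ i j k l, K i j * K k l
          = K (Equiv.swap i j k) (Equiv.swap i j l) * K i j := by
        intro i j k l
        by_cases hkl : k = l
        · subst hkl; simp [hKii]
        · have h1 := haad k l
          have h2 := haad (Equiv.swap i j k) (Equiv.swap i j l)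
          have hkl' : Equiv.swap i j k ≠ Equiv.swap i j l := fun h => hkl ((Equiv.swap i j).injective h)
          rw [if_neg hkl, zero_sub] at h1
          rw [if_neg hkl', zero_sub] at h2
          have h3 : K i j * (a k * x l - x l * a k) = (a (Equiv.swap i j k) * x (Equiv.swap i j l)
              - x (Equiv.swap i j l) * a (Equiv.swap i j k)) * K i j := by
            rw [mul_sub, ← mul_assoc, ← mul_assoc, hKa, hKx, mul_assoc, mul_assoc, hKa, hKx]
            noncomm_ring
          rw [h1, h2, mul_neg, neg_mul, neg_inj, mul_smul_comm, smul_mul_assoc] at h3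
          exact smul_right_injective A hβ h3
      exact ((show Commute _ _ from T_comm x K φ hφ hKsymm hKii hKx hKK n m).smul_left β).smul_right β
  refine Commute.add_left (Commute.add_right ?_ ?_) (Commute.add_right ?_ hTT)
  · exact ((hφφ _ _).smul_left _).smul_right _
  · exact ((hpT _ _).smul_left _).smul_right _
  · exact ((hpT _ _).symm.smul_left _).smul_right _
end
end Witt


/-- The generators `L_{-n} = ∑_i (α (a_i†)^{n+1} a_i + (1-α) a_i (a_i†)^{n+1})` built from
the deformed oscillator algebra realize the Witt (centerless Virasoro) algebra:
`[L_{-n}, L_{-m}] = (m - n) L_{-(n+m)}` (i.e. `[L_n, L_m] = (n - m) L_{n+m}`, restricted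
to the polynomial regime `n, m ≤ 0` via nonnegative exponents). -/
theorem stmt16 {A : Type*} [Ring A] [Algebra ℝ A] (N : ℕ) (hN : 2 ≤ N) (α β : ℝ)
    (a ad : Fin N → A) (K : Fin N → Fin N → A)
    (hKsymm : ∀ i j, K i j = K j i)
    (hKii : ∀ i, K i i = 1)
    (hK2 : ∀ i j, K i j * K i j = 1)
    (haa : ∀ i j, a i * a j = a j * a i)
    (hadad : ∀ i j, ad i * ad j = ad j * ad i)
    (haad : ∀ i j, a i * ad j - ad j * a i
      = (if i = j then 1 + β • ∑ l, K i l else 0) - β • K i j)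
    (hKa : ∀ i j, K i j * a j = a i * K i j)
    (hKad : ∀ i j, K i j * ad j = ad i * K i j)
    (hKa' : ∀ i j k, k ≠ i → k ≠ j → K i j * a k = a k * K i j)
    (hKad' : ∀ i j k, k ≠ i → k ≠ j → K i j * ad k = ad k * K i j)
    (L : ℕ → A)
    (hL : ∀ n : ℕ, L n = ∑ i, (α • (ad i ^ (n + 1) * a i)
      + (1 - α) • (a i * ad i ^ (n + 1))))
    (n m : ℕ) :
    L n * L m - L m * L n = ((m : ℝ) - (n : ℝ)) • L (n + m) := by
  have sw : ∀ y : Fin N → A, (∀ i j, K i j * y j = y i * K i j) →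
      (∀ i j k, k ≠ i → k ≠ j → K i j * y k = y k * K i j) →
      ∀ i j k, K i j * y k = y (Equiv.swap i j k) * K i j := by
    intro y h1 h2 i j k
    by_cases hi : k = i
    · subst hi
      rw [Equiv.swap_apply_left, hKsymm, h1]
    · by_cases hj : k = j
      · subst hj
        rw [Equiv.swap_apply_right, h1]
      · rw [Equiv.swap_apply_of_ne_of_ne hi hj, h2 i j k hi hj]
  have hA := sw a hKa hKa'
  have hX := sw ad hKad hKad'
  have hE := Witt.E_witt β a ad K hKsymm hX haa hadad haad n m
  have hF := Witt.F_witt β a ad K hKsymm hX haa hadad haad n m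
  have hC := (Witt.C_comm β a ad K hKsymm hKii hX hA hadad haad n m).eq
  simp only [Finset.sum_sub_distrib] at hC
  simp only [hL, Finset.sum_add_distrib, ← Finset.smul_sum]
  generalize (∑ i, ad i ^ (n + 1) * a i) = E1 at *
  generalize (∑ i, ad i ^ (m + 1) * a i) = E2 at *
  generalize (∑ i, ad i ^ (n + m + 1) * a i) = E3 at *
  generalize (∑ i, a i * ad i ^ (n + 1)) = F1 at *
  generalize (∑ i, a i * ad i ^ (m + 1)) = F2 at *
  generalize (∑ i, a i * ad i ^ (n + m + 1)) = F3 at *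
  have hX : (E1 * F2 - F2 * E1) + (F1 * E2 - E2 * F1)
      = ((m : ℝ) - n) • E3 + ((m : ℝ) - n) • F3 := by
    rw [← hE, ← hF, ← sub_eq_zero]
    rw [← sub_eq_zero] at hC
    rw [← neg_eq_zero, ← hC]
    noncomm_ring
  have key : (α • E1 + (1 - α) • F1) * (α • E2 + (1 - α) • F2)
      - (α • E2 + (1 - α) • F2) * (α • E1 + (1 - α) • F1)
      = (α * α) • (E1 * E2 - E2 * E1) + ((1 - α) * (1 - α)) • (F1 * F2 - F2 * F1)
        + (α * (1 - α)) • ((E1 * F2 - F2 * E1) + (F1 * E2 - E2 * F1)) := by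
    simp only [add_mul, mul_add, smul_mul_smul_comm]
    module
  rw [key, hE, hF, hX]
  module
end
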